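/- arXiv:2203.12096 — 2 statements merged into one kernel-verified Lean document; each statement's English description precedes it below -/
import Mathlib

section
/- Let 𝔹 be a bivariant theory for which every absolute product square is independent and the independent squares have the cancellation property. Let α₁ ∈ 𝔹(X₁ → Y₁) and α₂ ∈ 𝔹(X₂ → Y₂), and suppose X₁ → Y₁ factors through a confined morphism f₁ : X₁ → X'₁ and X₂ → Y₂ factors through a confined morphism f₂ : X₂ → X'₂. Then the product morphism f₁ × f₂ : X₁ × X₂ → X'₁ × X'₂ is confined and (f₁ × f₂)_*(α₁ × α₂) = f₁_*(α₁) × f₂_*(α₂) in 𝔹(X'₁ × X'₂ → Y₁ × Y₂). -/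
open CategoryTheory CategoryTheory.Limits

universe w w' u' v u

/-- A bivariant functoriality on a category `C` with a final object and all fiber
products: a class of confined morphisms (containing all isomorphisms, closed under
composition and pullback), a class of independent Cartesian squares (containing all
squares in which one pair of parallel sides consists of identities, closed under
horizontal and vertical composition) and a class of specialized morphisms
(containing all isomorphisms and closed under composition).

A square is recorded by its bottom `bot : X ⟶ Y`, top `top : X' ⟶ Y'`, left
vertical `l : X' ⟶ X` and right vertical `r : Y' ⟶ Y`; it is Cartesian when
`IsPullback top l r bot` holds. -/
structure BivFun (C : Type u) [Category.{v} C] where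
  pt : C
  isTerminal_pt : IsTerminal pt
  hasPullbacks : HasPullbacks C
  confined : ∀ ⦃X Y : C⦄, (X ⟶ Y) → Prop
  confined_of_isIso : ∀ ⦃X Y : C⦄ (f : X ⟶ Y), IsIso f → confined f
  confined_comp : ∀ ⦃X Y Z : C⦄ {f : X ⟶ Y} {g : Y ⟶ Z},
    confined f → confined g → confined (f ≫ g)
  confined_pullback : ∀ ⦃X Y X' Y' : C⦄ {bot : X ⟶ Y} {top : X' ⟶ Y'} {l : X' ⟶ X}
    {r : Y' ⟶ Y}, IsPullback top l r bot → confined bot → confined top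
  indep : ∀ ⦃X Y X' Y' : C⦄ (bot : X ⟶ Y) (top : X' ⟶ Y') (l : X' ⟶ X) (r : Y' ⟶ Y), Prop
  indep_isPullback : ∀ ⦃X Y X' Y' : C⦄ {bot : X ⟶ Y} {top : X' ⟶ Y'} {l : X' ⟶ X}
    {r : Y' ⟶ Y}, indep bot top l r → IsPullback top l r bot
  indep_vert_id : ∀ ⦃X Y : C⦄ (f : X ⟶ Y), indep f f (𝟙 X) (𝟙 Y)
  indep_horiz_id : ∀ ⦃X Y : C⦄ (f : X ⟶ Y), indep (𝟙 Y) (𝟙 X) f f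
  indep_vcomp : ∀ ⦃X Y X' Y' X'' Y'' : C⦄ {f : X ⟶ Y} {f' : X' ⟶ Y'} {f'' : X'' ⟶ Y''}
    {l : X' ⟶ X} {r : Y' ⟶ Y} {l' : X'' ⟶ X'} {r' : Y'' ⟶ Y'},
    indep f f' l r → indep f' f'' l' r' → indep f f'' (l' ≫ l) (r' ≫ r)
  indep_hcomp : ∀ ⦃X Y Z X' Y' Z' : C⦄ {f : X ⟶ Y} {g : Y ⟶ Z} {f' : X' ⟶ Y'}
    {g' : Y' ⟶ Z'} {l : X' ⟶ X} {m : Y' ⟶ Y} {r : Z' ⟶ Z},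
    indep f f' l m → indep g g' m r → indep (f ≫ g) (f' ≫ g') l r
  specialized : ∀ ⦃X Y : C⦄, (X ⟶ Y) → Prop
  specialized_of_isIso : ∀ ⦃X Y : C⦄ (f : X ⟶ Y), IsIso f → specialized f
  specialized_comp : ∀ ⦃X Y Z : C⦄ {f : X ⟶ Y} {g : Y ⟶ Z},
    specialized f → specialized g → specialized (f ≫ g)

variable {C : Type u} [Category.{v} C]

/-- The structure morphism to the final object `pt`. -/
def BivFun.tm (F : BivFun C) (X : C) : X ⟶ F.pt := F.isTerminal_pt.from X

/-- The data of a bivariant theory with functoriality `F`: an abelian group for every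
morphism, bivariant pushforwards along confined morphisms, bivariant pullbacks along
independent squares, bivariant products, and units. -/
structure BivData (F : BivFun C) where
  grp : ∀ ⦃X Y : C⦄, (X ⟶ Y) → Type w
  addCommGroup : ∀ ⦃X Y : C⦄ (f : X ⟶ Y), AddCommGroup (grp f)
  push : ∀ ⦃X X' Y : C⦄ (g : X ⟶ X') (h : X' ⟶ Y), F.confined g → grp (g ≫ h) → grp h
  pull : ∀ ⦃X Y X' Y' : C⦄ {bot : X ⟶ Y} {top : X' ⟶ Y'} {l : X' ⟶ X} {r : Y' ⟶ Y},
    F.indep bot top l r → grp bot → grp top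
  mul : ∀ ⦃X Y Z : C⦄ {f : X ⟶ Y} {g : Y ⟶ Z}, grp f → grp g → grp (f ≫ g)
  one : ∀ (X : C), grp (𝟙 X)

attribute [instance] BivData.addCommGroup

variable {F : BivFun C}

/-- Transport of bivariant elements along an equality of morphisms. -/
def BivData.tr (B : BivData.{w} F) {X Y : C} {f g : X ⟶ Y} (h : f = g) :
    B.grp f → B.grp g := fun a => h ▸ a

/-- The Fulton–MacPherson bivariant axioms. -/
structure IsBivTheory (B : BivData.{w} F) : Prop where
  push_add : ∀ ⦃X X' Y : C⦄ (g : X ⟶ X') (h : X' ⟶ Y) (hg : F.confined g)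
    (α β : B.grp (g ≫ h)), B.push g h hg (α + β) = B.push g h hg α + B.push g h hg β
  pull_add : ∀ ⦃X Y X' Y' : C⦄ {bot : X ⟶ Y} {top : X' ⟶ Y'} {l : X' ⟶ X} {r : Y' ⟶ Y}
    (hsq : F.indep bot top l r) (α β : B.grp bot),
    B.pull hsq (α + β) = B.pull hsq α + B.pull hsq β
  mul_add_left : ∀ ⦃X Y Z : C⦄ {f : X ⟶ Y} {g : Y ⟶ Z} (α α' : B.grp f) (β : B.grp g),
    B.mul (α + α') β = B.mul α β + B.mul α' β
  mul_add_right : ∀ ⦃X Y Z : C⦄ {f : X ⟶ Y} {g : Y ⟶ Z} (α : B.grp f) (β β' : B.grp g),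
    B.mul α (β + β') = B.mul α β + B.mul α β'
  mul_assoc : ∀ ⦃X Y Z W : C⦄ {f : X ⟶ Y} {g : Y ⟶ Z} {h : Z ⟶ W}
    (α : B.grp f) (β : B.grp g) (γ : B.grp h),
    B.mul (B.mul α β) γ = B.tr (Category.assoc f g h).symm (B.mul α (B.mul β γ))
  push_id : ∀ ⦃X Y : C⦄ (f : X ⟶ Y) (h1 : F.confined (𝟙 X)) (α : B.grp (𝟙 X ≫ f)),
    B.push (𝟙 X) f h1 α = B.tr (Category.id_comp f) α
  push_comp : ∀ ⦃X X' X'' Y : C⦄ (f : X ⟶ X') (g : X' ⟶ X'') (h : X'' ⟶ Y)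
    (hf : F.confined f) (hg : F.confined g) (α : B.grp (f ≫ g ≫ h)),
    B.push g h hg (B.push f (g ≫ h) hf α) =
      B.push (f ≫ g) h (F.confined_comp hf hg) (B.tr (Category.assoc f g h).symm α)
  pull_id : ∀ ⦃X Y : C⦄ (f : X ⟶ Y) (α : B.grp f), B.pull (F.indep_vert_id f) α = α
  pull_comp : ∀ ⦃X Y X' Y' X'' Y'' : C⦄ {f : X ⟶ Y} {f' : X' ⟶ Y'} {f'' : X'' ⟶ Y''}
    {l : X' ⟶ X} {r : Y' ⟶ Y} {l' : X'' ⟶ X'} {r' : Y'' ⟶ Y'}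
    (h1 : F.indep f f' l r) (h2 : F.indep f' f'' l' r') (α : B.grp f),
    B.pull h2 (B.pull h1 α) = B.pull (F.indep_vcomp h1 h2) α
  push_mul : ∀ ⦃X X' Y Z : C⦄ (f : X ⟶ X') (h : X' ⟶ Y) (g : Y ⟶ Z) (hf : F.confined f)
    (α : B.grp (f ≫ h)) (β : B.grp g),
    B.push f (h ≫ g) hf (B.tr (Category.assoc f h g) (B.mul α β)) =
      B.mul (B.push f h hf α) β
  pull_mul : ∀ ⦃X Y Z X' Y' Z' : C⦄ {f : X ⟶ Y} {g : Y ⟶ Z} {f' : X' ⟶ Y'} {g' : Y' ⟶ Z'}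
    {l : X' ⟶ X} {m : Y' ⟶ Y} {r : Z' ⟶ Z}
    (h1 : F.indep f f' l m) (h2 : F.indep g g' m r) (α : B.grp f) (β : B.grp g),
    B.pull (F.indep_hcomp h1 h2) (B.mul α β) = B.mul (B.pull h1 α) (B.pull h2 β)
  push_pull : ∀ ⦃X Y Z X' Y' Z' : C⦄ (f : X ⟶ Y) (k : Y ⟶ Z) (f' : X' ⟶ Y') (k' : Y' ⟶ Z')
    (l : X' ⟶ X) (m : Y' ⟶ Y) (r : Z' ⟶ Z) (hf : F.confined f)
    (hleft : IsPullback f' l m f) (hbig : F.indep (f ≫ k) (f' ≫ k') l r)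
    (hright : F.indep k k' m r) (α : B.grp (f ≫ k)),
    B.pull hright (B.push f k hf α) =
      B.push f' k' (F.confined_pullback hleft hf) (B.pull hbig α)
  proj_formula : ∀ ⦃X Y X' Y' Z : C⦄ {b : X' ⟶ Y'} {t : X ⟶ Y} {g' : X ⟶ X'} {g : Y ⟶ Y'}
    (hsq : F.indep b t g' g) (hg : F.confined g) (c : Y' ⟶ Z)
    (α : B.grp (g ≫ c)) (β : B.grp b),
    B.push g' (b ≫ c) (F.confined_pullback (F.indep_isPullback hsq).flip hg)
        (B.tr (by rw [← Category.assoc, (F.indep_isPullback hsq).w, Category.assoc])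
          (B.mul (B.pull hsq β) α)) =
      B.mul β (B.push g c hg α)
  one_mul : ∀ ⦃X Y : C⦄ {f : X ⟶ Y} (α : B.grp f),
    B.tr (Category.id_comp f) (B.mul (B.one X) α) = α
  mul_one : ∀ ⦃X Y : C⦄ {f : X ⟶ Y} (α : B.grp f),
    B.tr (Category.comp_id f) (B.mul α (B.one Y)) = α

/-- The cohomology pullback `f^* : 𝔹^•(Y) → 𝔹^•(X)` along an arbitrary morphism, using
the independent square whose horizontal sides are `f` and whose vertical sides are
identities. -/
def cohPull (B : BivData.{w} F) {X Y : C} (f : X ⟶ Y) : B.grp (𝟙 Y) → B.grp (𝟙 X) :=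
  B.pull (F.indep_horiz_id f)

/-- The ring multiplication on the cohomology `𝔹^•(X) = 𝔹(𝟙 X)`. -/
def cohMul (B : BivData.{w} F) {X : C} (α β : B.grp (𝟙 X)) : B.grp (𝟙 X) :=
  B.tr (Category.id_comp (𝟙 X)) (B.mul α β)

/-- The homology pushforward `f_* : 𝔹_•(X) → 𝔹_•(Y)` along a confined morphism. -/
def homPush (B : BivData.{w} F) {X Y : C} (f : X ⟶ Y) (hf : F.confined f) :
    B.grp (F.tm X) → B.grp (F.tm Y) :=
  fun a => B.push f (F.tm Y) hf (B.tr (F.isTerminal_pt.hom_ext _ _) a)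

/-- The left action of the cohomology ring `𝔹^•(X)` on the homology `𝔹_•(X)`. -/
def cohSmul (B : BivData.{w} F) {X : C} (α : B.grp (𝟙 X)) (a : B.grp (F.tm X)) :
    B.grp (F.tm X) :=
  B.tr (Category.id_comp (F.tm X)) (B.mul α a)

/-- Every absolute product square (the Cartesian square with corners `X × Y`, `X`,
`Y`, `pt`) is independent. -/
def AbsIndep (F : BivFun C) : Prop :=
  ∀ ⦃X Y P : C⦄ (p1 : P ⟶ X) (p2 : P ⟶ Y),
    IsPullback p1 p2 (F.tm X) (F.tm Y) → F.indep (F.tm X) p2 p1 (F.tm Y)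

/-- Vertical cancellation for independent squares: for a vertical composite of two
Cartesian squares, independence of the composite square and of the bottom square
implies independence of the top square. -/
def CancelVert (F : BivFun C) : Prop :=
  ∀ ⦃X Y X' Y' X'' Y'' : C⦄ {f : X ⟶ Y} {f' : X' ⟶ Y'} {f'' : X'' ⟶ Y''}
    {l : X' ⟶ X} {r : Y' ⟶ Y} {l' : X'' ⟶ X'} {r' : Y'' ⟶ Y'},
    IsPullback f'' l' r' f' → F.indep f f'' (l' ≫ l) (r' ≫ r) → F.indep f f' l r →
      F.indep f' f'' l' r'

/-- Horizontal cancellation for independent squares: for a horizontal composite of two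
Cartesian squares, independence of the composite square and of the right-hand square
implies independence of the left-hand square. -/
def CancelHoriz (F : BivFun C) : Prop :=
  ∀ ⦃X Y Z X' Y' Z' : C⦄ {f : X ⟶ Y} {g : Y ⟶ Z} {f' : X' ⟶ Y'} {g' : Y' ⟶ Z'}
    {l : X' ⟶ X} {m : Y' ⟶ Y} {r : Z' ⟶ Z},
    IsPullback f' l m f → F.indep (f ≫ g) (f' ≫ g') l r → F.indep g g' m r →
      F.indep f f' l m

/-- The data of the product diagram used to define the bivariant cross product of
`α₁ ∈ 𝔹(X₁ → Y₁)` (a class on `φ₁`) and `α₂ ∈ 𝔹(X₂ → Y₂)` (a class on `φ₂`), with a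
fixed product `PY = Y₁ × Y₂` with projections `py1`, `py2`; it records the products
`QX = Y₁ × X₂`, `RY = X₁ × Y₂` and `SX = X₁ × X₂`, the induced morphisms
`g = id × φ₂ : QX ⟶ PY`, `t = φ₁ × id : RY ⟶ PY`, `t' = φ₁ × id : SX ⟶ QX` and
`u = id × φ₂ : SX ⟶ RY`, and the independence of the relevant squares of the product
diagram (which follows from independence of the absolute product squares and the
cancellation property). -/
structure CrossDiagram (F : BivFun C) {X₁ Y₁ X₂ Y₂ PY : C} (φ₁ : X₁ ⟶ Y₁)
    (φ₂ : X₂ ⟶ Y₂) (py1 : PY ⟶ Y₁) (py2 : PY ⟶ Y₂) where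
  QX : C
  q1 : QX ⟶ Y₁
  q2 : QX ⟶ X₂
  isProd_Q : IsPullback q1 q2 (F.tm Y₁) (F.tm X₂)
  RY : C
  r1 : RY ⟶ X₁
  r2 : RY ⟶ Y₂
  isProd_R : IsPullback r1 r2 (F.tm X₁) (F.tm Y₂)
  SX : C
  s1 : SX ⟶ X₁
  s2 : SX ⟶ X₂
  isProd_S : IsPullback s1 s2 (F.tm X₁) (F.tm X₂)
  g : QX ⟶ PY
  hg1 : g ≫ py1 = q1
  hg2 : g ≫ py2 = q2 ≫ φ₂
  t : RY ⟶ PY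
  ht1 : t ≫ py1 = r1 ≫ φ₁
  ht2 : t ≫ py2 = r2
  t' : SX ⟶ QX
  ht'1 : t' ≫ q1 = s1 ≫ φ₁
  ht'2 : t' ≫ q2 = s2
  u : SX ⟶ RY
  hu1 : u ≫ r1 = s1
  hu2 : u ≫ r2 = s2 ≫ φ₂
  indep_f : F.indep φ₁ t r1 py1
  indep_h : F.indep φ₂ g q2 py2
  indep_g : F.indep t t' u g

/-- The bivariant cross product `α₁ × α₂ := g^*(f^*(α₁)) • h^*(α₂)`, an element of
`𝔹(X₁ × X₂ → Y₁ × Y₂)`, i.e. a class on the morphism `t' ≫ g : SX ⟶ PY`. -/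
def CrossDiagram.cross {X₁ Y₁ X₂ Y₂ PY : C} {φ₁ : X₁ ⟶ Y₁} {φ₂ : X₂ ⟶ Y₂}
    {py1 : PY ⟶ Y₁} {py2 : PY ⟶ Y₂} (D : CrossDiagram F φ₁ φ₂ py1 py2)
    (B : BivData.{w} F) (α₁ : B.grp φ₁) (α₂ : B.grp φ₂) : B.grp (D.t' ≫ D.g) :=
  B.mul (B.pull D.indep_g (B.pull D.indep_f α₁)) (B.pull D.indep_h α₂)

theorem BivData.tr_tr (B : BivData.{w} F) {X Y : C} {f g h : X ⟶ Y} (e : f = g) (e' : g = h)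
    (α : B.grp f) : B.tr e' (B.tr e α) = B.tr (e.trans e') α := by
  subst e e'
  rfl

theorem BivData.tr_push (B : BivData.{w} F) {X X' Y : C} (g : X ⟶ X') {h h' : X' ⟶ Y}
    (e : h = h') (hg : F.confined g) (α : B.grp (g ≫ h)) :
    B.tr e (B.push g h hg α) = B.push g h' hg (B.tr (congrArg (g ≫ ·) e) α) := by
  subst e
  rfl

theorem BivData.pull_congr (B : BivData.{w} F) {X Y X' Y' : C} {bot : X ⟶ Y} {top : X' ⟶ Y'}
    {l l' : X' ⟶ X} {r r' : Y' ⟶ Y} (h : F.indep bot top l r) (h' : F.indep bot top l' r')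
    (el : l = l') (er : r = r') (α : B.grp bot) : B.pull h α = B.pull h' α := by
  subst el er
  rfl

/-- For products `P = X × Y` and `P' = X' × Y` and `f : X ⟶ X'`, the morphism
`f × id : P ⟶ P'` is the base change of `f` along the first projection. -/
theorem BivFun.isPullback_prod_map (F : BivFun C) {X X' Y P P' : C} {p1 : P ⟶ X} {p2 : P ⟶ Y}
    {p1' : P' ⟶ X'} {p2' : P' ⟶ Y} (hP : IsPullback p1 p2 (F.tm X) (F.tm Y))
    (hP' : IsPullback p1' p2' (F.tm X') (F.tm Y)) {f : X ⟶ X'} {a : P ⟶ P'}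
    (h1 : a ≫ p1' = p1 ≫ f) (h2 : a ≫ p2' = p2) : IsPullback a p1 p1' f := by
  refine IsPullback.of_right ?_ h1 hP'.flip
  rw [h2, F.isTerminal_pt.hom_ext (f ≫ F.tm X') (F.tm X)]
  exact hP.flip

/-- For products `P = X × Y` and `P' = X' × Y` and `f : X ⟶ X'`, the square exhibiting
`f × id : P ⟶ P'` as a base change of `f` is independent. -/
theorem BivFun.indep_prod_map (F : BivFun C) (habs : AbsIndep F) (hch : CancelHoriz F)
    {X X' Y P P' : C} {p1 : P ⟶ X} {p2 : P ⟶ Y}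
    {p1' : P' ⟶ X'} {p2' : P' ⟶ Y} (hP : IsPullback p1 p2 (F.tm X) (F.tm Y))
    (hP' : IsPullback p1' p2' (F.tm X') (F.tm Y)) {f : X ⟶ X'} {a : P ⟶ P'}
    (h1 : a ≫ p1' = p1 ≫ f) (h2 : a ≫ p2' = p2) : F.indep f a p1 p1' := by
  refine hch (g := F.tm X') (g' := p2') (r := F.tm Y)
    (F.isPullback_prod_map hP hP' h1 h2) ?_ (habs _ _ hP')
  rw [h2, F.isTerminal_pt.hom_ext (f ≫ F.tm X') (F.tm X)]
  exact habs _ _ hP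

/-- Compatibility of iterated pullback, product and pushforward for a product diagram whose
horizontal maps factor as `a ≫ k` and whose vertical maps factor through `b` and `c`. -/
theorem IsBivTheory.push_mul_pull_pull {B : BivData.{w} F} (hB : IsBivTheory B)
    {X₁ X₁' Y₁ X₂ X₂' Y₂ P Q Q' R R' S S' Z : C}
    {f₁ : X₁ ⟶ X₁'} {h₁ : X₁' ⟶ Y₁} (hf₁ : F.confined f₁)
    {f₂ : X₂ ⟶ X₂'} {h₂ : X₂' ⟶ Y₂} (hf₂ : F.confined f₂)
    {py1 : P ⟶ Y₁} {py2 : P ⟶ Y₂} {a : S ⟶ Z} {b : Z ⟶ S'} {k : Z ⟶ Q} {c : Q ⟶ Q'}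
    {g' : Q' ⟶ P} {t : R ⟶ P} {u : S ⟶ R} {r1 : R ⟶ X₁} {q2 : Q ⟶ X₂}
    {t' : R' ⟶ P} {t'' : S' ⟶ Q'} {u' : S' ⟶ R'} {r1' : R' ⟶ X₁'} {q2' : Q' ⟶ X₂'}
    (hf : F.indep (f₁ ≫ h₁) t r1 py1) (hh : F.indep (f₂ ≫ h₂) (c ≫ g') q2 py2)
    (hg : F.indep t (a ≫ k) u (c ≫ g'))
    (hf' : F.indep h₁ t' r1' py1) (hh' : F.indep h₂ g' q2' py2) (hg' : F.indep t' t'' u' g')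
    (hbc : F.indep t'' k b c) (hac : IsPullback a (u ≫ r1) (b ≫ u' ≫ r1') f₁)
    (hcq : IsPullback c q2 q2' f₂) (hab : F.confined (a ≫ b))
    (e : (a ≫ k) ≫ c ≫ g' = (a ≫ b) ≫ t'' ≫ g')
    (α₁ : B.grp (f₁ ≫ h₁)) (α₂ : B.grp (f₂ ≫ h₂)) :
    B.push (a ≫ b) (t'' ≫ g') hab
        (B.tr e (B.mul (B.pull hg (B.pull hf α₁)) (B.pull hh α₂))) =
      B.mul (B.pull hg' (B.pull hf' (B.push f₁ h₁ hf₁ α₁)))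
        (B.pull hh' (B.push f₂ h₂ hf₂ α₂)) := by
  have hk : F.indep h₁ k (b ≫ u' ≫ r1') ((c ≫ g') ≫ py1) := by
    simpa using F.indep_vcomp (F.indep_vcomp hf' hg') hbc
  rw [hB.push_pull f₂ h₂ c g' q2 q2' py2 hf₂ hcq hh hh', ← hB.proj_formula hbc,
    hB.pull_comp hf' hg', hB.pull_comp _ hbc,
    B.pull_congr (F.indep_vcomp (F.indep_vcomp hf' hg') hbc) hk rfl (Category.assoc ..).symm,
    hB.push_pull f₁ h₁ a k _ _ _ hf₁ hac (F.indep_vcomp hf hg) hk, ← hB.push_mul, B.tr_push,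
    hB.push_comp, B.tr_tr, B.tr_tr, hB.pull_comp hf hg]

/-- Let `𝔹` be a bivariant theory such that every absolute product
square is independent and the independent squares have the cancellation property.
Let `α₁ ∈ 𝔹(X₁ → Y₁)` and `α₂ ∈ 𝔹(X₂ → Y₂)`, and suppose `X₁ → Y₁` factors through a
confined `f₁ : X₁ ⟶ X₁'` and `X₂ → Y₂` factors through a confined `f₂ : X₂ ⟶ X₂'`.
Then the product morphism `f₁ × f₂ : X₁ × X₂ ⟶ X₁' × X₂'` (the morphism `f₁₂`,
characterized by commuting with the projections) is confined, and
`(f₁ × f₂)_*(α₁ × α₂) = f₁_*(α₁) × f₂_*(α₂)` in `𝔹(X₁' × X₂' → Y₁ × Y₂)`. -/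
theorem cross_product_pushforward {C : Type u} [Category.{v} C] (F : BivFun C)
    (B : BivData.{w} F) (hB : IsBivTheory B)
    (habs : AbsIndep F) (hcv : CancelVert F) (hch : CancelHoriz F)
    {X₁ X₁' Y₁ X₂ X₂' Y₂ PY : C}
    (f₁ : X₁ ⟶ X₁') (h₁ : X₁' ⟶ Y₁) (hf₁ : F.confined f₁)
    (f₂ : X₂ ⟶ X₂') (h₂ : X₂' ⟶ Y₂) (hf₂ : F.confined f₂)
    (py1 : PY ⟶ Y₁) (py2 : PY ⟶ Y₂) (hPY : IsPullback py1 py2 (F.tm Y₁) (F.tm Y₂))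
    (D : CrossDiagram F (f₁ ≫ h₁) (f₂ ≫ h₂) py1 py2)
    (D' : CrossDiagram F h₁ h₂ py1 py2)
    (f₁₂ : D.SX ⟶ D'.SX) (hq1 : f₁₂ ≫ D'.s1 = D.s1 ≫ f₁)
    (hq2 : f₁₂ ≫ D'.s2 = D.s2 ≫ f₂)
    (hfact : D.t' ≫ D.g = f₁₂ ≫ (D'.t' ≫ D'.g))
    (α₁ : B.grp (f₁ ≫ h₁)) (α₂ : B.grp (f₂ ≫ h₂)) :
    F.confined f₁₂ ∧
      ∀ (hc : F.confined f₁₂),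
        B.push f₁₂ (D'.t' ≫ D'.g) hc (B.tr hfact (D.cross B α₁ α₂)) =
          D'.cross B (B.push f₁ h₁ hf₁ α₁) (B.push f₂ h₂ hf₂ α₂) := by
  have := F.hasPullbacks
  have hZ : IsPullback (pullback.fst (F.tm X₁') (F.tm X₂)) (pullback.snd (F.tm X₁') (F.tm X₂))
      (F.tm X₁') (F.tm X₂) := IsPullback.of_hasPullback _ _
  generalize pullback.fst (F.tm X₁') (F.tm X₂) = z1 at hZ
  generalize pullback.snd (F.tm X₁') (F.tm X₂) = z2 at hZ
  obtain ⟨QX, q1, q2, hQ, RY, r1, r2, hR, SX, s1, s2, hS, g, hg1, hg2, t, ht1, ht2, t', ht'1, ht'2,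
    u, hu1, hu2, hf, hh, hg⟩ := D
  obtain ⟨a, ha1, ha2⟩ := hZ.exists_lift (s1 ≫ f₁) s2 (F.isTerminal_pt.hom_ext _ _)
  obtain ⟨b, hb1, hb2⟩ := D'.isProd_S.exists_lift z1 (z2 ≫ f₂) (F.isTerminal_pt.hom_ext _ _)
  obtain ⟨c, hc1, hc2⟩ := D'.isProd_Q.exists_lift q1 (q2 ≫ f₂) (F.isTerminal_pt.hom_ext _ _)
  obtain ⟨k, hk1, hk2⟩ := hQ.exists_lift (z1 ≫ h₁) z2 (F.isTerminal_pt.hom_ext _ _)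
  dsimp only at f₁₂ hq1 hq2 hfact
  have hab : a ≫ b = f₁₂ := by
    apply D'.isProd_S.hom_ext
    · rw [Category.assoc, hb1, ha1, hq1]
    · rw [Category.assoc, hb2, reassoc_of% ha2, hq2]
  have hak : a ≫ k = t' := by
    apply hQ.hom_ext
    · rw [Category.assoc, hk1, reassoc_of% ha1, ht'1]
    · rw [Category.assoc, hk2, ha2, ht'2]
  have hcg : c ≫ D'.g = g := by
    apply hPY.hom_ext
    · rw [Category.assoc, D'.hg1, hc1, hg1]
    · rw [Category.assoc, D'.hg2, reassoc_of% hc2, hg2]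
  have hbk : k ≫ c = b ≫ D'.t' := by
    apply D'.isProd_Q.hom_ext
    · rw [Category.assoc, Category.assoc, hc1, hk1, D'.ht'1, reassoc_of% hb1]
    · rw [Category.assoc, Category.assoc, hc2, reassoc_of% hk2, D'.ht'2, hb2]
  subst hab hak hcg
  have hpa := F.isPullback_prod_map hS hZ ha1 ha2
  have hpb := F.isPullback_prod_map hZ.flip D'.isProd_S.flip hb2 hb1
  have hpc := F.isPullback_prod_map hQ.flip D'.isProd_Q.flip hc2 hc1
  have hbu : b ≫ D'.u ≫ D'.r1 = z1 := by rw [D'.hu1, hb1]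
  have hcp : c ≫ D'.g ≫ py1 = q1 := by rw [D'.hg1, hc1]
  have hk : F.indep h₁ k (b ≫ D'.u ≫ D'.r1) (c ≫ D'.g ≫ py1) := by
    rw [hbu, hcp]
    exact F.indep_prod_map habs hch hZ hQ hk1 hk2
  have hf'g' := F.indep_vcomp D'.indep_f D'.indep_g
  have hbc : F.indep D'.t' k b c :=
    hcv (IsPullback.of_bot (F.indep_isPullback hk) hbk (F.indep_isPullback hf'g')) hk hf'g'
  refine ⟨F.confined_comp (F.confined_pullback hpa hf₁) (F.confined_pullback hpb hf₂),
    fun hc => ?_⟩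
  exact hB.push_mul_pull_pull hf₁ hf₂ hf hh hg D'.indep_f D'.indep_h D'.indep_g hbc
    (by rw [hu1, hbu]; exact hpa) hpc hc hfact α₁ α₂
end

section
/- Let 𝔹 be a centrally and stably oriented bivariant theory such that all absolute product squares are independent and the independent squares have the cancellation property. Then for all specialized morphisms f : X' → X and g : Y' → Y and all α ∈ 𝔹_•(X), β ∈ 𝔹_•(Y), one has (f × g)^!(α × β) = f^!(α) × g^!(β) in 𝔹_•(X' × Y'). -/
open CategoryTheory CategoryTheory.Limits

universe w w' u' v u

variable {C : Type u} [Category.{v} C]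

variable {F : BivFun C}

/-- An orientation of a bivariant theory: a canonical element `θ(f)` for every
specialized morphism, normalized and multiplicative. -/
structure BivOrientation (B : BivData.{w} F) where
  θ : ∀ ⦃X Y : C⦄ (f : X ⟶ Y), F.specialized f → B.grp f
  θ_id : ∀ (X : C), θ (𝟙 X) (F.specialized_of_isIso (𝟙 X) inferInstance) = B.one X
  θ_comp : ∀ ⦃X Y Z : C⦄ (f : X ⟶ Y) (g : Y ⟶ Z) (hf : F.specialized f)
    (hg : F.specialized g),
    θ (f ≫ g) (F.specialized_comp hf hg) = B.mul (θ f hf) (θ g hg)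

/-- A stable orientation: specialized morphisms are stable under independent
pullbacks, and the orientation is stable under independent pullbacks. -/
structure StableOrientation (B : BivData.{w} F) extends BivOrientation B where
  specialized_pullback : ∀ ⦃X Y X' Y' : C⦄ {bot : X ⟶ Y} {top : X' ⟶ Y'} {l : X' ⟶ X}
    {r : Y' ⟶ Y}, F.indep bot top l r → F.specialized bot → F.specialized top
  θ_pullback : ∀ ⦃X Y X' Y' : C⦄ {bot : X ⟶ Y} {top : X' ⟶ Y'} {l : X' ⟶ X}
    {r : Y' ⟶ Y} (hsq : F.indep bot top l r) (hs : F.specialized bot),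
    B.pull hsq (θ bot hs) = θ top (specialized_pullback hsq hs)

variable {B : BivData.{w} F}

/-- The Gysin pushforward `f_! : 𝔹^•(X) → 𝔹^•(Y)`, `f_!(α) = f_*(α • θ(f))`, along a
confined and specialized morphism. -/
def BivOrientation.gysinPush (O : BivOrientation B) {X Y : C} (f : X ⟶ Y)
    (hc : F.confined f) (hs : F.specialized f) : B.grp (𝟙 X) → B.grp (𝟙 Y) :=
  fun α => B.push f (𝟙 Y) hc
    (B.tr (show 𝟙 X ≫ f = f ≫ 𝟙 Y by simp) (B.mul α (O.θ f hs)))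

/-- The Gysin pullback `g^! : 𝔹_•(Y) → 𝔹_•(X)`, `g^!(β) = θ(g) • β`, along a
specialized morphism. -/
def BivOrientation.gysinPull (O : BivOrientation B) {X Y : C} (g : X ⟶ Y)
    (hs : F.specialized g) : B.grp (F.tm Y) → B.grp (F.tm X) :=
  fun a => B.tr (F.isTerminal_pt.hom_ext _ _) (B.mul (O.θ g hs) a)

/-- A centrally (and stably) oriented bivariant theory: the class of independent
squares is symmetric (closed under transposition), and for every independent square
with specialized bottom `f` and right side `g`, `g^*(θ(f)) • α = f^*(α) • θ(f)`,
where `f^*` is the pullback along the transposed square. -/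
structure CentralOrientation (B : BivData.{w} F) extends StableOrientation B where
  indep_symm : ∀ ⦃X Y X' Y' : C⦄ {bot : X ⟶ Y} {top : X' ⟶ Y'} {l : X' ⟶ X}
    {r : Y' ⟶ Y}, F.indep bot top l r → F.indep r l top bot
  central : ∀ ⦃X Y X' Y' : C⦄ {f : X ⟶ Y} {top : X' ⟶ Y'} {l : X' ⟶ X} {g : Y' ⟶ Y}
    (hsq : F.indep f top l g) (hf : F.specialized f) (α : B.grp g),
    B.mul (B.pull hsq (θ f hf)) α =
      B.tr (F.indep_isPullback hsq).w.symm (B.mul (B.pull (indep_symm hsq) α) (θ f hf))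

/-- The homological cross product `α × β := π^*(α) • β ∈ 𝔹_•(X × Y)`, where `π^*` is
the pullback along the (independent) absolute product square with right-hand vertical
`π_Y : Y ⟶ pt`, top `p2 : P ⟶ Y` and left vertical `p1 : P ⟶ X`. -/
def homCross (B : BivData.{w} F) {X Y P : C} {p1 : P ⟶ X} {p2 : P ⟶ Y}
    (hind : F.indep (F.tm X) p2 p1 (F.tm Y)) (a : B.grp (F.tm X))
    (b : B.grp (F.tm Y)) : B.grp (F.tm P) :=
  B.tr (F.isTerminal_pt.hom_ext _ _) (B.mul (B.pull hind a) b)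

theorem BivData.tr_heq (B : BivData.{w} F) {X Y : C} {f g : X ⟶ Y} (h : f = g)
    (a : B.grp f) : B.tr h a ≍ a := by
  subst h; rfl

theorem BivData.mul_heq (B : BivData.{w} F) {X Y Z : C} {f f' : X ⟶ Y} {g g' : Y ⟶ Z}
    (hf : f = f') (hg : g = g') {a : B.grp f} {a' : B.grp f'} {b : B.grp g} {b' : B.grp g'}
    (ha : a ≍ a') (hb : b ≍ b') : B.mul a b ≍ B.mul a' b' := by
  subst hf hg; cases ha; cases hb; rfl

theorem BivData.pull_heq (B : BivData.{w} F) {X Y X' Y' : C} {bot bot' : X ⟶ Y}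
    {top top' : X' ⟶ Y'} {l l' : X' ⟶ X} {r r' : Y' ⟶ Y}
    (hbot : bot = bot') (htop : top = top') (hl : l = l') (hr : r = r')
    (h : F.indep bot top l r) (h' : F.indep bot' top' l' r')
    {a : B.grp bot} {a' : B.grp bot'} (ha : a ≍ a') : B.pull h a ≍ B.pull h' a' := by
  subst hbot htop hl hr; cases ha; rfl

theorem BivOrientation.θ_heq {B : BivData.{w} F} (O : BivOrientation B) {X Y : C}
    {f f' : X ⟶ Y} (h : f = f') (hf : F.specialized f) (hf' : F.specialized f') :
    O.θ f hf ≍ O.θ f' hf' := by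
  subst h; rfl

theorem IsBivTheory.mul_assoc_heq {B : BivData.{w} F} (hB : IsBivTheory B) {X Y Z W : C}
    {f : X ⟶ Y} {g : Y ⟶ Z} {h : Z ⟶ W} (a : B.grp f) (b : B.grp g) (c : B.grp h) :
    B.mul (B.mul a b) c ≍ B.mul a (B.mul b c) := by
  rw [hB.mul_assoc]; exact B.tr_heq _ _

theorem BivFun.comp_tm (F : BivFun C) {X Y : C} (f : X ⟶ Y) : f ≫ F.tm Y = F.tm X :=
  F.isTerminal_pt.hom_ext _ _

/-- Let `𝔹` be a centrally and stably oriented bivariant theory such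
that all absolute product squares are independent and the independent squares have
the cancellation property.  Then for all specialized morphisms `f : X' ⟶ X` and
`g : Y' ⟶ Y` (so that the product morphism `f × g : X' × Y' ⟶ X × Y`, characterized
by commuting with the projections, is again specialized) and all `α ∈ 𝔹_•(X)`,
`β ∈ 𝔹_•(Y)`, one has `(f × g)^!(α × β) = f^!(α) × g^!(β)` in `𝔹_•(X' × Y')`. -/
theorem cross_product_gysin_pullback {C : Type u} [Category.{v} C] (F : BivFun C)
    (B : BivData.{w} F) (hB : IsBivTheory B) (O : CentralOrientation B)
    (habs : AbsIndep F) (hcv : CancelVert F) (hch : CancelHoriz F)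
    {X Y X' Y' : C} (f : X' ⟶ X) (g : Y' ⟶ Y)
    (hf : F.specialized f) (hg : F.specialized g)
    {P : C} (p1 : P ⟶ X) (p2 : P ⟶ Y) (hP : IsPullback p1 p2 (F.tm X) (F.tm Y))
    {P' : C} (p1' : P' ⟶ X') (p2' : P' ⟶ Y')
    (hP' : IsPullback p1' p2' (F.tm X') (F.tm Y'))
    (fg : P' ⟶ P) (hfg1 : fg ≫ p1 = p1' ≫ f) (hfg2 : fg ≫ p2 = p2' ≫ g)
    (hfgs : F.specialized fg)
    (α : B.grp (F.tm X)) (β : B.grp (F.tm Y)) :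
    O.toBivOrientation.gysinPull fg hfgs (homCross B (habs p1 p2 hP) α β) =
      homCross B (habs p1' p2' hP') (O.toBivOrientation.gysinPull f hf α)
        (O.toBivOrientation.gysinPull g hg β) := by
  have := F.hasPullbacks
  -- `R` is the product of `X` and `Y'`, constructed as the base change of `X × Y` along `g`.
  obtain ⟨R, q2, g', hR⟩ : ∃ (R : C) (q2 : R ⟶ Y') (g' : R ⟶ P), IsPullback q2 g' g p2 :=
    ⟨_, _, _, IsPullback.of_hasPullback g p2⟩
  have hRabs : IsPullback (g' ≫ p1) q2 (F.tm X) (F.tm Y') := by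
    rw [← F.comp_tm g]
    exact (hR.paste_vert hP.flip).flip
  have hindR := habs _ _ hRabs
  have hindR' : F.indep (F.tm X) q2 (g' ≫ p1) (g ≫ F.tm Y) := by
    rw [F.comp_tm g]; exact hindR
  have hsq_g : F.indep p2 q2 g' g := hcv hR hindR' (habs p1 p2 hP)
  let f' : P' ⟶ R := hR.lift p2' fg hfg2.symm
  have hf'q : f' ≫ q2 = p2' := hR.lift_fst _ _ _
  have hf'g : f' ≫ g' = fg := hR.lift_snd _ _ _
  have hpb' : IsPullback (f' ≫ q2) p1' (F.tm Y') (f ≫ F.tm X) := by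
    rw [hf'q, F.comp_tm f]; exact hP'.flip
  have hpb_f : IsPullback f' p1' (g' ≫ p1) f :=
    IsPullback.of_right hpb' (by rw [← Category.assoc, hf'g, hfg1]) hRabs.flip
  have hindP' : F.indep (f ≫ F.tm X) (f' ≫ q2) p1' (F.tm Y') := by
    rw [hf'q, F.comp_tm f]; exact habs p1' p2' hP'
  have hsq_f : F.indep f f' p1' (g' ≫ p1) := hch hpb_f hindP' hindR
  have hf's := O.specialized_pullback hsq_f hf
  have hg's := O.specialized_pullback (O.indep_symm hsq_g) hg
  set αP := B.pull (habs p1 p2 hP) α with hαP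
  have hpullR : B.pull hindR α ≍ B.pull hsq_g αP := by
    rw [hαP, hB.pull_comp]
    exact B.pull_heq rfl rfl rfl (F.comp_tm g).symm _ _ HEq.rfl
  have hcentral : B.mul (O.θ g' hg's) αP ≍ B.mul (B.pull hsq_g αP) (O.θ g hg) := by
    rw [← O.θ_pullback (O.indep_symm hsq_g) hg, O.central]
    exact B.tr_heq _ _
  have hpullP' : B.pull (habs p1' p2' hP') (O.toBivOrientation.gysinPull f hf α) ≍
      B.mul (O.θ f' hf's) (B.pull hindR α) := by
    rw [← O.θ_pullback hsq_f hf, ← hB.pull_mul]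
    exact B.pull_heq (F.comp_tm f).symm hf'q.symm rfl rfl _ _ (B.tr_heq _ _)
  have hθ : O.θ fg hfgs ≍ B.mul (O.θ f' hf's) (O.θ g' hg's) := by
    rw [← O.θ_comp]
    exact O.θ_heq hf'g.symm _ _
  have hassoc : B.mul (B.mul (O.θ f' hf's) (O.θ g' hg's)) αP ≍
      B.mul (B.mul (O.θ f' hf's) (B.pull hsq_g αP)) (O.θ g hg) :=
    (hB.mul_assoc_heq _ _ _).trans <|
      (B.mul_heq rfl hR.w.symm HEq.rfl hcentral).trans (hB.mul_assoc_heq _ _ _).symm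
  have hlhs : O.toBivOrientation.gysinPull fg hfgs (homCross B (habs p1 p2 hP) α β) ≍
      B.mul (B.mul (B.mul (O.θ f' hf's) (O.θ g' hg's)) αP) β :=
    (B.tr_heq _ _).trans <|
      (B.mul_heq hf'g.symm (F.isTerminal_pt.hom_ext _ _) hθ (B.tr_heq _ _)).trans
        (hB.mul_assoc_heq _ _ _).symm
  have hrhs : homCross B (habs p1' p2' hP') (O.toBivOrientation.gysinPull f hf α)
        (O.toBivOrientation.gysinPull g hg β) ≍
      B.mul (B.mul (B.mul (O.θ f' hf's) (B.pull hsq_g αP)) (O.θ g hg)) β :=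
    (B.tr_heq _ _).trans <|
      (B.mul_heq hf'q.symm (F.comp_tm g).symm
        (hpullP'.trans (B.mul_heq rfl rfl HEq.rfl hpullR)) (B.tr_heq _ _)).trans
          (hB.mul_assoc_heq _ _ _).symm
  exact eq_of_heq <| hlhs.trans <|
    (B.mul_heq (by rw [Category.assoc, hR.w.symm, Category.assoc]) rfl hassoc HEq.rfl).trans
      hrhs.symm
end
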